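/- (One-step invariance of the bounds on the value function in Algorithm 1, inequalities (74)–(76) in the proof of Proposition 6.) Assume δ > 2Ū and set K = δ + √(δ(δ − 2Ū)). Let 0 < Δt < 1/(δ + K). Let U be a matrix with 0 ≤ U_{i,j} ≤ Ū for all (i,j), and let m and Φ be matrices such that m_{i,j} ≥ 0 for all (i,j), Σ_{i=1}^{N_x} m_{i,j} = 1 for every j, and 0 ≤ Φ_{i,j} ≤ K for all (i,j). Define Φ'_{i,j} = Φ_{i,j} + δ Δt · H_{i,j}(m, Φ). Then 0 ≤ Φ'_{i,j} ≤ K for all (i,j). -/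

import Mathlib

/-- Discretized HJB operator:
`H_{i,j}(m, Φ) = −Φ_{i,j} + U_{i,j} + (1/(2δ)) Σ_k ((Φ_{k,j} − Φ_{i,j})₊)² m_{k,j}`. -/
noncomputable def Hop {Nx Ny : ℕ} (δ : ℝ) (Umat m Φ : Fin Nx → Fin Ny → ℝ)
    (i : Fin Nx) (j : Fin Ny) : ℝ :=
  -Φ i j + Umat i j + (1 / (2 * δ)) * ∑ k, (max (Φ k j - Φ i j) 0) ^ 2 * m k j

/-- **One-step invariance of the bounds on the value function in Algorithm 1**
(inequalities (74)–(76) in the proof of Proposition 6). -/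
theorem stmt13
    (Nx Ny : ℕ) [NeZero Nx] [NeZero Ny]
    (Ubar δ : ℝ) (hUbar : 0 < Ubar) (hδ : 2 * Ubar < δ)
    (K : ℝ) (hK : K = δ + Real.sqrt (δ * (δ - 2 * Ubar)))
    (Δt : ℝ) (hΔt0 : 0 < Δt) (hΔt : Δt < 1 / (δ + K))
    (Umat : Fin Nx → Fin Ny → ℝ)
    (hU : ∀ i j, 0 ≤ Umat i j ∧ Umat i j ≤ Ubar)
    (m Φ : Fin Nx → Fin Ny → ℝ)
    (hm : ∀ i j, 0 ≤ m i j) (hms : ∀ j, ∑ i, m i j = 1)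
    (hΦ : ∀ i j, 0 ≤ Φ i j ∧ Φ i j ≤ K) :
    ∀ i j, 0 ≤ Φ i j + δ * Δt * Hop δ Umat m Φ i j ∧
      Φ i j + δ * Δt * Hop δ Umat m Φ i j ≤ K := by
  intro i j
  have hδ0 : 0 < δ := by linarith
  have hs0 := Real.sqrt_nonneg (δ * (δ - 2 * Ubar))
  have hsq := Real.sq_sqrt (show 0 ≤ δ * (δ - 2 * Ubar) by
    apply mul_nonneg <;> linarith)
  have hKs : K ^ 2 = 2 * δ * K - 2 * δ * Ubar := by
    rw [hK]; linear_combination hsq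
  have hKδ : δ ≤ K := by linarith
  have hΔ : Δt * (δ + K) < 1 := by
    rwa [lt_div_iff₀ (by linarith)] at hΔt
  have hδΔ : δ * Δt ≤ 1 := by nlinarith [mul_pos hΔt0 (lt_of_lt_of_le hδ0 hKδ)]
  have hδΔ0 : 0 < δ * Δt := mul_pos hδ0 hΔt0
  obtain ⟨hx0, hxK⟩ := hΦ i j
  obtain ⟨hu0, hu1⟩ := hU i j
  have hS0 : 0 ≤ ∑ k, (max (Φ k j - Φ i j) 0) ^ 2 * m k j :=
    Finset.sum_nonneg fun k _ => mul_nonneg (sq_nonneg _) (hm k j)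
  have hS1 : ∑ k, (max (Φ k j - Φ i j) 0) ^ 2 * m k j ≤ (K - Φ i j) ^ 2 := by
    calc _ ≤ ∑ k, (K - Φ i j) ^ 2 * m k j := by
          refine Finset.sum_le_sum fun k _ => mul_le_mul_of_nonneg_right ?_ (hm k j)
          refine pow_le_pow_left₀ (le_max_right _ _) (max_le ?_ ?_) 2
          · linarith [(hΦ k j).2]
          · linarith
      _ = _ := by rw [← Finset.mul_sum, hms, mul_one]
  unfold Hop
  generalize (∑ k, (max (Φ k j - Φ i j) 0) ^ 2 * m k j) = S at *
  generalize Φ i j = x at *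
  generalize Umat i j = u at *
  have hT0 : 0 ≤ 1 / (2 * δ) * S := by positivity
  have hT1 : 1 / (2 * δ) * S ≤ K - Ubar := by
    rw [one_div_mul_eq_div, div_le_iff₀ (by linarith)]
    nlinarith
  constructor
  · nlinarith [mul_nonneg hδΔ0.le hu0, mul_nonneg hδΔ0.le hT0]
  · have h1 : -x + u + 1 / (2 * δ) * S ≤ K - x := by linarith
    nlinarith [mul_le_mul_of_nonneg_left h1 hδΔ0.le]
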